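/- Let A be a 3×3 real matrix with a₁₂ < 0, a₁₃ > 0, a₂₁ > 0, a₂₃ < 0, a₃₁ < 0, a₃₂ > 0, and zero diagonal. Then for k₀ > max{-a₁₂a₂₁ - a₁₃a₃₁ - a₂₃a₃₂, -a₃₂a₂₃ - a₁₃a₃₁}, every entry of A² + k₀I is strictly positive; hence A is algebraically positive. -/

import Mathlib

open Polynomial Matrix

/-- A real square matrix is algebraically positive if some real polynomial
applied to it has all entries strictly positive. -/
def AlgPos {m : Type*} [Fintype m] [DecidableEq m] (A : Matrix m m ℝ) : Prop :=
  ∃ p : Polynomial ℝ, ∀ i j, 0 < (Polynomial.aeval A p) i j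

theorem sp184_algPos (A : Matrix (Fin 3) (Fin 3) ℝ)
    (h12 : A 0 1 < 0) (h13 : 0 < A 0 2) (h21 : 0 < A 1 0)
    (h23 : A 1 2 < 0) (h31 : A 2 0 < 0) (h32 : 0 < A 2 1)
    (h11 : A 0 0 = 0) (h22 : A 1 1 = 0) (h33 : A 2 2 = 0) :
    (∀ k₀ : ℝ, k₀ > max (-(A 0 1 * A 1 0) - A 0 2 * A 2 0 - A 1 2 * A 2 1)
        (-(A 2 1 * A 1 2) - A 0 2 * A 2 0) →
      ∀ i j, 0 < (A ^ 2 + k₀ • (1 : Matrix (Fin 3) (Fin 3) ℝ)) i j) ∧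
    AlgPos A := by
  have key : ∀ k₀ : ℝ, k₀ > max (-(A 0 1 * A 1 0) - A 0 2 * A 2 0 - A 1 2 * A 2 1)
        (-(A 2 1 * A 1 2) - A 0 2 * A 2 0) →
      ∀ i j, 0 < (A ^ 2 + k₀ • (1 : Matrix (Fin 3) (Fin 3) ℝ)) i j := by
    intro k₀ hk
    obtain ⟨hk, -⟩ := max_lt_iff.mp hk
    have d12 := mul_neg_of_neg_of_pos h12 h21
    have d13 := mul_neg_of_pos_of_neg h13 h31
    have d23 := mul_neg_of_neg_of_pos h23 h32
    have e01 := mul_pos h13 h32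
    have e02 := mul_pos_of_neg_of_neg h12 h23
    have e10 := mul_pos_of_neg_of_neg h23 h31
    have e12 := mul_pos h21 h13
    have e20 := mul_pos h32 h21
    have e21 := mul_pos_of_neg_of_neg h31 h12
    intro i j
    fin_cases i <;> fin_cases j <;>
      simp [pow_two, Matrix.mul_apply, Fin.sum_univ_three, h11, h22, h33] <;> linarith
  refine ⟨key, X ^ 2 + C (max (-(A 0 1 * A 1 0) - A 0 2 * A 2 0 - A 1 2 * A 2 1)
    (-(A 2 1 * A 1 2) - A 0 2 * A 2 0) + 1), ?_⟩
  rw [map_add, map_pow, aeval_X, aeval_C, Algebra.algebraMap_eq_smul_one]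
  exact key _ (lt_add_one _)
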